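/- Let n ≥ 1, let E = ℝⁿ (Euclidean space), and fix α with 0 < α < 1. Define the Gaussian transition kernel K(x, x') = (2π(1−α))^{−n/2} · exp(−‖x − √α·x'‖²/(2(1−α))) for x, x' ∈ E. Let q : E → ℝ be a measurable, nonnegative, integrable function with ∫ q(x') dx' = 1 and ∫ ‖x'‖ · q(x') dx' < ∞. Define f(x) = ∫ K(x, x') q(x') dx' and, for x with f(x) > 0, define m(x) = (∫ x' · K(x, x') q(x') dx') / f(x). Then f(x) > 0 for every x ∈ E, f is differentiable on E, and for every x ∈ E the identity (1/√α)·(x + (1−α)·∇(log f)(x)) = m(x) holds, where ∇ denotes the gradient. -/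

import Mathlib

open Real MeasureTheory

section GaussianKernel

theorem exp_neg_norm_sq_div_le_one {E : Type*} [SeminormedAddCommGroup E] {v : ℝ} (hv : 0 < v)
    (z : E) : exp (-‖z‖ ^ 2 / (2 * v)) ≤ 1 :=
  exp_le_one_iff.2 (div_nonpos_of_nonpos_of_nonneg (by simp) (by positivity))

variable {E : Type*} [NormedAddCommGroup E] [InnerProductSpace ℝ E]

theorem hasGradientAt_exp_neg_norm_sub_sq_div [CompleteSpace E] (v : ℝ) (z x : E) :
    HasGradientAt (fun y => exp (-‖y - z‖ ^ 2 / (2 * v)))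
      (-(exp (-‖x - z‖ ^ 2 / (2 * v)) / v) • (x - z)) x := by
  rw [hasGradientAt_iff_hasFDerivAt]
  have h := ((((hasFDerivAt_id (𝕜 := ℝ) x).sub_const z).norm_sq.neg).mul_const (2 * v)⁻¹).exp
  simp only [← div_eq_mul_inv] at h
  refine h.congr_fderiv ?_
  ext y
  simp only [id_eq, Pi.neg_apply, smul_apply, neg_apply,
    ContinuousLinearMap.comp_apply, ContinuousLinearMap.id_apply, innerSL_apply_apply,
    InnerProductSpace.toDual_apply_apply, inner_smul_left, smul_eq_mul, nsmul_eq_mul,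
    conj_trivial]
  push_cast
  rw [mul_inv]
  ring

variable [MeasurableSpace E] [BorelSpace E] {μ : Measure E}
  {q : E → ℝ} {v : ℝ}

theorem integrable_gaussian_mul (hv : 0 < v) (s : ℝ) (hq : Integrable q μ) (x : E) :
    Integrable (fun a => exp (-‖x - s • a‖ ^ 2 / (2 * v)) * q a) μ := by
  refine hq.bdd_mul (c := 1) (Continuous.aestronglyMeasurable (by fun_prop))
    (.of_forall fun a => ?_)
  rw [norm_of_nonneg (exp_pos _).le]
  exact exp_neg_norm_sq_div_le_one hv _

theorem integrable_gaussian_mul_smul [SecondCountableTopology E] (hv : 0 < v) (s : ℝ)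
    (hq : Integrable q μ) (hq' : Integrable (fun a => ‖a‖ * q a) μ) (x : E) :
    Integrable (fun a => (exp (-‖x - s • a‖ ^ 2 / (2 * v)) * q a) • a) μ := by
  have hm := (integrable_gaussian_mul hv s hq x).aestronglyMeasurable
  refine (integrable_gaussian_mul hv s hq' x).mono (hm.smul aestronglyMeasurable_id)
    (.of_forall fun a => ?_)
  simp only [norm_smul, norm_mul, norm_norm]
  exact le_of_eq (by ring)

/-- Differentiation under the integral sign for a scaled Gaussian convolution. -/
theorem hasGradientAt_integral_gaussian_mul [CompleteSpace E] [SecondCountableTopology E]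
    (hv : 0 < v) (s : ℝ) (hq : Integrable q μ) (hq' : Integrable (fun a => ‖a‖ * q a) μ) (x : E) :
    HasGradientAt (fun y => ∫ a, exp (-‖y - s • a‖ ^ 2 / (2 * v)) * q a ∂μ)
      (v⁻¹ • (s • (∫ a, (exp (-‖x - s • a‖ ^ 2 / (2 * v)) * q a) • a ∂μ) -
        (∫ a, exp (-‖x - s • a‖ ^ 2 / (2 * v)) * q a ∂μ) • x)) x := by
  set g : E → E → E := fun y a =>
    q a • (-(exp (-‖y - s • a‖ ^ 2 / (2 * v)) / v) • (y - s • a)) with hg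
  have hg_eq : g x = fun a => v⁻¹ • (s • ((exp (-‖x - s • a‖ ^ 2 / (2 * v)) * q a) • a) -
      (exp (-‖x - s • a‖ ^ 2 / (2 * v)) * q a) • x) := by
    ext1 a
    simp only [hg]
    module
  have hi := integrable_gaussian_mul hv s hq x
  have hi' := integrable_gaussian_mul_smul hv s hq hq' x
  have hg_int : Integrable (g x) μ := by
    rw [hg_eq]
    exact ((hi'.smul s).sub (hi.smul_const x)).smul v⁻¹
  have hg_integral : ∫ a, g x a ∂μ =
      v⁻¹ • (s • (∫ a, (exp (-‖x - s • a‖ ^ 2 / (2 * v)) * q a) • a ∂μ) -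
        (∫ a, exp (-‖x - s • a‖ ^ 2 / (2 * v)) * q a ∂μ) • x) := by
    rw [hg_eq, integral_smul, integral_sub (by exact hi'.smul s) (hi.smul_const x), integral_smul,
      integral_smul_const]
  have hF'_int : Integrable (fun a => InnerProductSpace.toDual ℝ E (g x a)) μ :=
    hg_int.mono
      ((InnerProductSpace.toDual ℝ E).continuous.comp_aestronglyMeasurable hg_int.1)
      (.of_forall fun a => by simp)
  have hmain := hasFDerivAt_integral_of_dominated_of_fderiv_le (𝕜 := ℝ) (μ := μ)
    (F := fun y a => exp (-‖y - s • a‖ ^ 2 / (2 * v)) * q a)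
    (F' := fun y a => InnerProductSpace.toDual ℝ E (g y a))
    (bound := fun a => v⁻¹ * ((‖x‖ + 1) * ‖q a‖ + |s| * ‖‖a‖ * q a‖))
    (Metric.ball_mem_nhds x one_pos)
    (.of_forall fun y => (integrable_gaussian_mul hv s hq y).1) hi hF'_int.1
    (.of_forall fun a y hy => ?_)
    (((hq.norm.const_mul _).add (hq'.norm.const_mul _)).const_mul _)
    (.of_forall fun a y _ => ?_)
  · rw [hasGradientAt_iff_hasFDerivAt]
    refine hmain.congr_fderiv ?_
    ext w
    rw [ContinuousLinearMap.integral_apply hF'_int, InnerProductSpace.toDual_apply_apply,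
      ← hg_integral, real_inner_comm, ← integral_inner hg_int]
    simp only [InnerProductSpace.toDual_apply_apply]
    exact integral_congr_ae (.of_forall fun a => real_inner_comm _ _)
  · have hy' : ‖y‖ ≤ ‖x‖ + 1 := by
      have := norm_le_norm_add_norm_sub' y x
      rw [mem_ball_iff_norm] at hy
      linarith
    have hsub : ‖y - s • a‖ ≤ (‖x‖ + 1) + |s| * ‖a‖ := by
      refine (norm_sub_le _ _).trans (add_le_add hy' ?_)
      rw [norm_smul, norm_eq_abs]
    rw [LinearIsometryEquiv.norm_map]
    simp only [hg, norm_smul, norm_neg, norm_div, norm_mul, norm_norm,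
      norm_of_nonneg (exp_pos _).le, norm_of_nonneg hv.le]
    calc _ ≤ ‖q a‖ * (1 / v * ((‖x‖ + 1) + |s| * ‖a‖)) := by
          gcongr
          exact exp_neg_norm_sq_div_le_one hv _
      _ = _ := by ring
  · have h := (hasGradientAt_exp_neg_norm_sub_sq_div v (s • a) y).hasFDerivAt.mul_const (q a)
    refine h.congr_fderiv ?_
    simp only [hg, map_smulₛₗ, conj_trivial]

theorem integral_gaussian_mul_pos (hv : 0 < v) (s : ℝ) (hq_nonneg : ∀ a, 0 ≤ q a)
    (hq : Integrable q μ) (hq_pos : 0 < ∫ a, q a ∂μ) (x : E) :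
    0 < ∫ a, exp (-‖x - s • a‖ ^ 2 / (2 * v)) * q a ∂μ := by
  rw [integral_pos_iff_support_of_nonneg hq_nonneg hq] at hq_pos
  rw [integral_pos_iff_support_of_nonneg
    (fun a => mul_nonneg (exp_pos _).le (hq_nonneg a)) (integrable_gaussian_mul hv s hq x)]
  convert hq_pos using 2
  ext a
  simp [exp_ne_zero]

end GaussianKernel

/-- Proposition 1: for the Gaussian transition kernel
`K(x,x') = (2π(1−α))^{−n/2} exp(−‖x − √α x'‖²/(2(1−α)))` and a probability density `q` with
finite first moment, the marginal `f(x) = ∫ K(x,x') q(x') dx'` is positive and differentiable,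
and `(1/√α)·(x + (1−α)·∇ log f(x))` equals the conditional posterior mean
`m(x) = (∫ x' K(x,x') q(x') dx') / f(x)`. -/
theorem diffusion_reverse_step_is_posterior_mean
    (n : ℕ) (hn : 1 ≤ n) (α : ℝ) (hα0 : 0 < α) (hα1 : α < 1)
    (K : EuclideanSpace ℝ (Fin n) → EuclideanSpace ℝ (Fin n) → ℝ)
    (hK : ∀ x x', K x x' =
      (2 * Real.pi * (1 - α)) ^ (-(n : ℝ) / 2) *
        Real.exp (-‖x - Real.sqrt α • x'‖ ^ 2 / (2 * (1 - α))))
    (q : EuclideanSpace ℝ (Fin n) → ℝ)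
    (hq_meas : Measurable q) (hq_nonneg : ∀ x', 0 ≤ q x')
    (hq_int : Integrable q) (hq_prob : ∫ x', q x' = 1)
    (hq_moment : Integrable (fun x' => ‖x'‖ * q x'))
    (f : EuclideanSpace ℝ (Fin n) → ℝ)
    (hf : ∀ x, f x = ∫ x', K x x' * q x') :
    (∀ x, 0 < f x) ∧ Differentiable ℝ f ∧
      ∀ x, (Real.sqrt α)⁻¹ • (x + (1 - α) • gradient (fun y => Real.log (f y)) x) =
        (f x)⁻¹ • ∫ x', (K x x' * q x') • x' := by
  set C : ℝ := (2 * Real.pi * (1 - α)) ^ (-(n : ℝ) / 2)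
  have hv : 0 < 1 - α := by linarith
  have hC : 0 < C := by positivity
  have hs : √α ≠ 0 := (Real.sqrt_pos.2 hα0).ne'
  have hfC : f = fun x =>
      C * ∫ a, Real.exp (-‖x - √α • a‖ ^ 2 / (2 * (1 - α))) * q a := by
    ext x
    simp only [hf, hK, mul_assoc, integral_const_mul]
  have hpos : ∀ x, 0 < f x := fun x => by
    rw [hfC]
    exact mul_pos hC (integral_gaussian_mul_pos hv _ hq_nonneg hq_int (by simp [hq_prob]) x)
  have hgrad : ∀ x, HasGradientAt f
      ((1 - α)⁻¹ • (√α • (∫ a, (K x a * q a) • a) - f x • x)) x := fun x => by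
    have h := (hasGradientAt_integral_gaussian_mul hv √α hq_int hq_moment x).hasFDerivAt.const_mul C
    rw [hasGradientAt_iff_hasFDerivAt]
    simp only [hK, hfC, mul_assoc, mul_smul C, integral_smul]
    refine h.congr_fderiv ?_
    rw [← conj_trivial C, ← map_smulₛₗ, conj_trivial]
    congr 1
    module
  refine ⟨hpos, fun x => (hgrad x).differentiableAt, fun x => ?_⟩
  have hlog : HasGradientAt (fun y => Real.log (f y))
      ((f x)⁻¹ • (1 - α)⁻¹ • (√α • (∫ a, (K x a * q a) • a) - f x • x)) x := by
    rw [hasGradientAt_iff_hasFDerivAt]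
    refine ((hgrad x).hasFDerivAt.log (hpos x).ne').congr_fderiv ?_
    simp only [map_smulₛₗ, conj_trivial]
  have hfx := (hpos x).ne'
  have hv' := hv.ne'
  rw [hlog.gradient]
  match_scalars <;> field_simp <;> ring
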